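/- Let k be a field of characteristic ≠ 2, n ≥ 1, (a_{ij}) a nonzero symmetric n × n matrix over k, and X = {x₁, …, xₙ}. Let C(n,f) be the Clifford dialgebra, i.e., the quotient of the free dialgebra D(X ∪ {e}) over k by the two-sided dialgebra ideal generated by the relations x_i ⊢ x_j + x_j ⊣ x_i − 2a_{ij}e (for all i, j), e ⊢ y − y, and y ⊣ e − y (for all y ∈ X ∪ {e}). Then the images in C(n,f) of the normal diwords ẏ ⊣ x_{i₁} ⊣ ⋯ ⊣ x_{i_k} with y ∈ X ∪ {e}, 1 ≤ i₁ < i₂ < ⋯ < i_k ≤ n, and k ≥ 0 (center at the first letter y), form a k-linear basis of C(n,f). -/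

import Mathlib

universe u v

/-- A dialgebra over a field `k`: a `k`-vector space with two bilinear associative
products `lp` (written `⊢` in the paper) and `rp` (written `⊣`) satisfying the three
dialgebra axioms. -/
class Dialgebra (k : Type*) (D : Type*) [Field k] [AddCommGroup D] [Module k D] where
  lp : D → D → D
  rp : D → D → D
  lp_add_left : ∀ a b c : D, lp (a + b) c = lp a c + lp b c
  lp_add_right : ∀ a b c : D, lp a (b + c) = lp a b + lp a c
  lp_smul_left : ∀ (r : k) (a b : D), lp (r • a) b = r • lp a b
  lp_smul_right : ∀ (r : k) (a b : D), lp a (r • b) = r • lp a b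
  rp_add_left : ∀ a b c : D, rp (a + b) c = rp a c + rp b c
  rp_add_right : ∀ a b c : D, rp a (b + c) = rp a b + rp a c
  rp_smul_left : ∀ (r : k) (a b : D), rp (r • a) b = r • rp a b
  rp_smul_right : ∀ (r : k) (a b : D), rp a (r • b) = r • rp a b
  lp_assoc : ∀ a b c : D, lp (lp a b) c = lp a (lp b c)
  rp_assoc : ∀ a b c : D, rp (rp a b) c = rp a (rp b c)
  di1 : ∀ a b c : D, rp a (lp b c) = rp (rp a b) c
  di2 : ∀ a b c : D, lp (rp a b) c = lp a (lp b c)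
  di3 : ∀ a b c : D, lp a (rp b c) = rp (lp a b) c

/-- A Leibniz algebra over a field `k`: a `k`-vector space with a bilinear bracket
satisfying the Leibniz identity `[[a,b],c] = [[a,c],b] + [a,[b,c]]`. -/
class LeibnizAlgebra (k : Type*) (L : Type*) [Field k] [AddCommGroup L] [Module k L] where
  br : L → L → L
  br_add_left : ∀ a b c : L, br (a + b) c = br a c + br b c
  br_add_right : ∀ a b c : L, br a (b + c) = br a b + br a c
  br_smul_left : ∀ (r : k) (a b : L), br (r • a) b = r • br a b
  br_smul_right : ∀ (r : k) (a b : L), br a (r • b) = r • br a b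
  leibniz : ∀ a b c : L, br (br a b) c = br (br a c) b + br a (br b c)

/-- A normal diword over `X`: a nonempty word in `X` together with a marked letter
(its center), recorded as the letters to the left of the center, the center, and the
letters to the right of the center. -/
structure NDiword (X : Type*) where
  left : List X
  center : X
  right : List X

namespace NDiword

variable {X : Type*}

/-- The underlying (associative) word of a normal diword. -/
def word (u : NDiword X) : List X := u.left ++ u.center :: u.right

/-- Concatenation with center at the center of the second factor: the product `⊢`
on normal diwords. -/
def lconc (u v : NDiword X) : NDiword X := ⟨u.word ++ v.left, v.center, v.right⟩

/-- Concatenation with center at the center of the first factor: the product `⊣`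
on normal diwords. -/
def rconc (u v : NDiword X) : NDiword X := ⟨u.left, u.center, u.right ++ v.word⟩

/-- The deg-lex order on normal diwords: compare `wt([u]) = (n+m+1, m, x₋ₘ, …, xₙ)`
lexicographically. -/
def dlt [LinearOrder X] (u v : NDiword X) : Prop :=
  u.word.length < v.word.length ∨
    (u.word.length = v.word.length ∧
      (u.left.length < v.left.length ∨
        (u.left.length = v.left.length ∧ List.Lex (· < ·) u.word v.word)))

end NDiword

/-- The free dialgebra on `X` over `k`: the free `k`-vector space on the set of
normal diwords over `X`. -/
abbrev FreeDialg (k : Type*) [Field k] (X : Type*) := NDiword X →₀ k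

/-- The one-letter normal diword `ẋ`, as an element of the free dialgebra. -/
noncomputable def ofX (k : Type*) [Field k] {X : Type*} (x : X) : FreeDialg k X :=
  Finsupp.single ⟨[], x, []⟩ 1

section FreeDialgebra

variable {k : Type*} [Field k] {X : Type*}

/-- The product `⊢` on the free dialgebra, extended bilinearly from normal diwords. -/
noncomputable def lmul (f g : FreeDialg k X) : FreeDialg k X :=
  f.sum fun u a => g.sum fun v b => Finsupp.single (u.lconc v) (a * b)

/-- The product `⊣` on the free dialgebra, extended bilinearly from normal diwords. -/
noncomputable def rmul (f g : FreeDialg k X) : FreeDialg k X :=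
  f.sum fun u a => g.sum fun v b => Finsupp.single (u.rconc v) (a * b)

/-- `x₁ ⊢ (x₂ ⊢ (⋯ ⊢ t))` for a word `a = x₁x₂⋯` of letters. -/
noncomputable def lfold (a : List X) (t : FreeDialg k X) : FreeDialg k X :=
  a.foldr (fun x s => lmul (ofX k x) s) t

/-- `((t ⊣ x₁) ⊣ x₂) ⊣ ⋯` for a word `b = x₁x₂⋯` of letters. -/
noncomputable def rfold (t : FreeDialg k X) (b : List X) : FreeDialg k X :=
  b.foldl (fun s x => rmul s (ofX k x)) t

/-- `f` is left normed: every normal diword in its support has its center at the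
last letter. -/
def LeftNormed (f : FreeDialg k X) : Prop := ∀ u ∈ f.support, u.right = ([] : List X)

/-- `f` is right normed: every normal diword in its support has its center at the
first letter. -/
def RightNormed (f : FreeDialg k X) : Prop := ∀ u ∈ f.support, u.left = ([] : List X)

/-- `u` is the leading term (maximal term in the deg-lex order) of `f`. -/
def IsMaxTerm [LinearOrder X] (f : FreeDialg k X) (u : NDiword X) : Prop :=
  u ∈ f.support ∧ ∀ v ∈ f.support, v ≠ u → v.dlt u

/-- `f` is monic: its leading coefficient is `1`. -/
def Monic [LinearOrder X] (f : FreeDialg k X) : Prop :=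
  ∃ u, IsMaxTerm f u ∧ f u = 1

/-- A context for an `s`-diword `[asb]`: a normal diword with one letter `x_k`
removed, where `s` is to be substituted.  `center a b` is the case `k = 0` (so
`[asb] = a ⊢ ⋯ ⊢ s ⊣ ⋯ ⊣ b`); `left a w` is the case `k < 0` (so
`[asb] = a ⊢ ⋯ ⊢ s ⊢ [w]` with the center inside `w`); `right w b` is the case
`k > 0` (so `[asb] = [w] ⊣ s ⊣ ⋯ ⊣ b` with the center inside `w`). -/
inductive Ctx (X : Type*) where
  | center (a b : List X)
  | left (a : List X) (w : NDiword X)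
  | right (w : NDiword X) (b : List X)

/-- The `s`-diword `[asb]` determined by a context: substitute `s` into the context. -/
noncomputable def Ctx.eval (s : FreeDialg k X) : Ctx X → FreeDialg k X
  | Ctx.center a b => rfold (lfold a s) b
  | Ctx.left a w => lfold a (lmul s (Finsupp.single w 1))
  | Ctx.right w b => rfold (rmul (Finsupp.single w 1) s) b

/-- Substituting a normal diword `t` into a context gives a normal diword `[atb]`. -/
def Ctx.subst {X : Type*} (t : NDiword X) : Ctx X → NDiword X
  | Ctx.center a b => ⟨a ++ t.left, t.center, t.right ++ b⟩
  | Ctx.left a w => ⟨a ++ t.word ++ w.left, w.center, w.right⟩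
  | Ctx.right w b => ⟨w.left, w.center, w.right ++ t.word ++ b⟩

/-- `[asb]` is a normal `s`-diword: either `s` sits at the center (`k = 0`), or
`k < 0` and `s` is left normed, or `k > 0` and `s` is right normed. -/
def IsNormalFor (s : FreeDialg k X) : Ctx X → Prop
  | Ctx.center _ _ => True
  | Ctx.left _ _ => LeftNormed s
  | Ctx.right _ _ => RightNormed s

/-- Membership in the two-sided dialgebra ideal generated by `S`. -/
inductive IdealGen (S : Set (FreeDialg k X)) : FreeDialg k X → Prop
  | of {s : FreeDialg k X} : s ∈ S → IdealGen S s
  | zero : IdealGen S 0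
  | add {f g : FreeDialg k X} : IdealGen S f → IdealGen S g → IdealGen S (f + g)
  | smul (r : k) {f : FreeDialg k X} : IdealGen S f → IdealGen S (r • f)
  | lmul_left (g : FreeDialg k X) {f : FreeDialg k X} : IdealGen S f → IdealGen S (lmul g f)
  | lmul_right (g : FreeDialg k X) {f : FreeDialg k X} : IdealGen S f → IdealGen S (lmul f g)
  | rmul_left (g : FreeDialg k X) {f : FreeDialg k X} : IdealGen S f → IdealGen S (rmul g f)
  | rmul_right (g : FreeDialg k X) {f : FreeDialg k X} : IdealGen S f → IdealGen S (rmul f g)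

/-- The two-sided dialgebra ideal `Id(S)` generated by `S`, as a submodule. -/
def dialgIdeal (S : Set (FreeDialg k X)) : Submodule k (FreeDialg k X) where
  carrier := {f | IdealGen S f}
  add_mem' := fun hf hg => IdealGen.add hf hg
  zero_mem' := IdealGen.zero
  smul_mem' := fun r _ hf => IdealGen.smul r hf

end FreeDialgebra

section GSB

variable {k : Type*} [Field k] {X : Type*}

/-- `h` is a linear combination `Σᵢ αᵢ [aᵢsᵢbᵢ]` of `sᵢ`-diwords with `sᵢ ∈ S`, where
each pair `(sᵢ, [aᵢ⋅bᵢ])` satisfies the property `P`. -/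
def IsCombination (S : Set (FreeDialg k X)) (h : FreeDialg k X)
    (P : FreeDialg k X → Ctx X → Prop) : Prop :=
  ∃ (n : ℕ) (α : Fin n → k) (s : Fin n → FreeDialg k X) (c : Fin n → Ctx X),
    (∀ i, s i ∈ S) ∧ (∀ i, P (s i) (c i)) ∧
    h = ∑ i, α i • (c i).eval (s i)

/-- The composition of left multiplication `x ⊣ f` is trivial modulo `S`. -/
def TrivLMul [LinearOrder X] (S : Set (FreeDialg k X)) (x : X) (f : FreeDialg k X) : Prop :=
  IsCombination S (rmul (ofX k x) f) fun s c =>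
    IsNormalFor s c ∧ RightNormed s ∧ RightNormed (c.eval s) ∧
      ∀ u m, IsMaxTerm s u → IsMaxTerm (rmul (ofX k x) f) m →
        (c.subst u).word.length ≤ m.word.length

/-- The composition of right multiplication `f ⊢ x` is trivial modulo `S`. -/
def TrivRMul [LinearOrder X] (S : Set (FreeDialg k X)) (x : X) (f : FreeDialg k X) : Prop :=
  IsCombination S (lmul f (ofX k x)) fun s c =>
    IsNormalFor s c ∧ LeftNormed s ∧ LeftNormed (c.eval s) ∧
      ∀ u m, IsMaxTerm s u → IsMaxTerm (lmul f (ofX k x)) m →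
        (c.subst u).word.length ≤ m.word.length

/-- All compositions of left multiplication in `S` are trivial modulo `S`. -/
def LMulCompsTrivial [LinearOrder X] (S : Set (FreeDialg k X)) : Prop :=
  ∀ f ∈ S, ¬ RightNormed f → ∀ x : X, TrivLMul S x f

/-- All compositions of right multiplication in `S` are trivial modulo `S`. -/
def RMulCompsTrivial [LinearOrder X] (S : Set (FreeDialg k X)) : Prop :=
  ∀ f ∈ S, ¬ LeftNormed f → ∀ x : X, TrivRMul S x f

/-- `h` is trivial modulo `(S, [w])`: it is a combination of normal `S`-diwords with
leading normal diwords `< [w]`; moreover all the summands are right (resp. left)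
normed `S`-diwords whenever the side condition `rn` (resp. `ln`) holds. -/
def TrivBelowWith [LinearOrder X] (S : Set (FreeDialg k X)) (h : FreeDialg k X)
    (w : NDiword X) (rn ln : Prop) : Prop :=
  IsCombination S h fun s c =>
    IsNormalFor s c ∧ (∀ u, IsMaxTerm s u → (c.subst u).dlt w) ∧
      (rn → RightNormed s ∧ RightNormed (c.eval s)) ∧
      (ln → LeftNormed s ∧ LeftNormed (c.eval s))

/-- All compositions of inclusion among elements of `S` are trivial. -/
def InclCompsTrivial [LinearOrder X] (S : Set (FreeDialg k X)) : Prop :=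
  ∀ f ∈ S, ∀ g ∈ S, ∀ (fb gb : NDiword X) (c : Ctx X),
    IsMaxTerm f fb → IsMaxTerm g gb → IsNormalFor g c → fb = c.subst gb →
      TrivBelowWith S (f - c.eval g) fb
        (RightNormed f ∧ RightNormed g ∧ RightNormed (c.eval g))
        (LeftNormed f ∧ LeftNormed g ∧ LeftNormed (c.eval g))

/-- A context with no letters before the substituted polynomial (shape `[fb]`). -/
def Ctx.noLeft {X : Type*} : Ctx X → Prop
  | Ctx.center a _ => a = []
  | Ctx.left a _ => a = []
  | Ctx.right _ _ => False

/-- A context with no letters after the substituted polynomial (shape `[ag]`). -/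
def Ctx.noRight {X : Type*} : Ctx X → Prop
  | Ctx.center _ b => b = []
  | Ctx.right _ b => b = []
  | Ctx.left _ _ => False

/-- All compositions of intersection among elements of `S` are trivial. -/
def IntersectCompsTrivial [LinearOrder X] (S : Set (FreeDialg k X)) : Prop :=
  ∀ f ∈ S, ∀ g ∈ S, ∀ (fb gb : NDiword X) (cf cg : Ctx X),
    IsMaxTerm f fb → IsMaxTerm g gb → IsNormalFor f cf → IsNormalFor g cg →
    cf.noLeft → cg.noRight → cf.subst fb = cg.subst gb →
    (cf.subst fb).word.length < fb.word.length + gb.word.length →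
      TrivBelowWith S (cf.eval f - cg.eval g) (cf.subst fb)
        (RightNormed f ∧ RightNormed g ∧ RightNormed (cf.eval f) ∧ RightNormed (cg.eval g))
        (LeftNormed f ∧ LeftNormed g ∧ LeftNormed (cf.eval f) ∧ LeftNormed (cg.eval g))

/-- `S` is a Gröbner–Shirshov basis in the free dialgebra: `S` is monic and all
compositions (left multiplication, right multiplication, inclusion, intersection)
of elements of `S` are trivial. -/
def IsGSB [LinearOrder X] (S : Set (FreeDialg k X)) : Prop :=
  (∀ f ∈ S, Monic f) ∧ LMulCompsTrivial S ∧ RMulCompsTrivial S ∧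
    InclCompsTrivial S ∧ IntersectCompsTrivial S

/-- `Irr(S)`: the normal diwords that are not of the form `[a[s̄]b]` for any `s ∈ S`
and normal `s`-diword `[asb]`. -/
def IrrSet [LinearOrder X] (S : Set (FreeDialg k X)) : Set (NDiword X) :=
  {u | ¬ ∃ s ∈ S, ∃ (c : Ctx X) (sb : NDiword X),
    IsMaxTerm s sb ∧ IsNormalFor s c ∧ u = c.subst sb}

end GSB

/-- The candidate basis family for the Clifford dialgebra: images of the normal
diwords `ẏ ⊣ x_{i₁} ⊣ ⋯ ⊣ x_{i_k}` with `y ∈ X ∪ {e}` and `i₁ < ⋯ < i_k`. -/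
noncomputable def cliffFam {k : Type*} [Field k] {n : ℕ}
    (N : Submodule k (FreeDialg k (Option (Fin n)))) :
    {p : Option (Fin n) × List (Fin n) // List.Chain' (· < ·) p.2} →
      FreeDialg k (Option (Fin n)) ⧸ N :=
  fun p => Submodule.Quotient.mk (Finsupp.single ⟨[], p.1.1, p.1.2.map some⟩ 1)

/-- Lower triangular matrix with symmetrization `2a`. -/
def cliffT {k : Type*} [Field k] {n : ℕ} (a : Fin n → Fin n → k) : Matrix (Fin n) (Fin n) k :=
  fun i j => if j < i then 2 * a i j else if i = j then a i j else 0

/-- The quadratic form. -/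
noncomputable def cliffQ {k : Type*} [Field k] {n : ℕ} (a : Fin n → Fin n → k) :
    QuadraticForm k (Fin n → k) :=
  LinearMap.BilinMap.toQuadraticMap (Matrix.toBilin' (cliffT a))

/-- The Clifford generators. -/
noncomputable def cliffX {k : Type*} [Field k] {n : ℕ} (a : Fin n → Fin n → k) (i : Fin n) :
    CliffordAlgebra (cliffQ a) :=
  CliffordAlgebra.ι (cliffQ a) (Pi.single i 1)

section CliffModel
variable {k : Type*} [Field k] {n : ℕ} (a : Fin n → Fin n → k)

theorem cliffQ_polar (hsym : ∀ i j, a i j = a j i) (i j : Fin n) :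
    QuadraticMap.polar (cliffQ a) (Pi.single i 1) (Pi.single j 1) = 2 * a i j := by
  rw [cliffQ, LinearMap.BilinMap.polar_toQuadraticMap, Matrix.toBilin'_single,
    Matrix.toBilin'_single]
  unfold cliffT
  rcases lt_trichotomy i j with h | h | h
  · rw [hsym i j]; simp [h, h.not_gt, h.ne]
  · subst h; simp [two_mul]
  · simp [h, h.not_gt, h.ne]

theorem cliffX_mul (hsym : ∀ i j, a i j = a j i) (i j : Fin n) :
    cliffX a i * cliffX a j + cliffX a j * cliffX a i = algebraMap k _ (2 * a i j) := by
  rw [← cliffQ_polar a hsym]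
  exact CliffordAlgebra.ι_mul_ι_add_swap _ _

theorem cliff_h : (-(Matrix.toBilin' (cliffT a)) :
    LinearMap.BilinForm k (Fin n → k)).toQuadraticMap = 0 - cliffQ a := by
  simp [cliffQ, LinearMap.BilinMap.toQuadraticMap_neg]

/-- Exterior generators. -/
noncomputable def extX (k : Type*) [Field k] {n : ℕ} (i : Fin n) :
    ExteriorAlgebra k (Fin n → k) :=
  ExteriorAlgebra.ι k (Pi.single i 1)

theorem contract_list (d : Module.Dual k (Fin n → k)) (l : List (Fin n))
    (h : ∀ j ∈ l, d (Pi.single j 1) = 0) :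
    CliffordAlgebra.contractLeft (Q := (0 : QuadraticForm k (Fin n → k))) d
      ((l.map (extX k)).prod : CliffordAlgebra (0 : QuadraticForm k (Fin n → k))) = 0 := by
  induction l with
  | nil => exact CliffordAlgebra.contractLeft_one (Q := (0 : QuadraticForm k (Fin n → k))) d
  | cons i l ih =>
    rw [List.map_cons, List.prod_cons]
    refine (CliffordAlgebra.contractLeft_ι_mul (Q := (0 : QuadraticForm k (Fin n → k))) d
      _ _).trans ?_
    rw [ih (fun j hj => h j (by simp [hj])), h i (by simp)]
    simp

theorem change_list (l : List (Fin n)) (hl : l.Pairwise (· < ·)) :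
    CliffordAlgebra.changeForm (cliff_h a) ((l.map (cliffX a)).prod) =
      ((l.map (extX k)).prod : ExteriorAlgebra k (Fin n → k)) := by
  induction l with
  | nil => exact CliffordAlgebra.changeForm_one _
  | cons i l ih =>
    rw [List.pairwise_cons] at hl
    rw [List.map_cons, List.prod_cons, List.map_cons, List.prod_cons, cliffX,
      CliffordAlgebra.changeForm_ι_mul, ih hl.2]
    rw [contract_list, sub_zero]
    · rfl
    · intro j hj
      have := hl.1 j hj
      rw [LinearMap.neg_apply, LinearMap.neg_apply, Matrix.toBilin'_single]
      simp [cliffT, this.not_gt, this.ne]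

theorem ext_basis_apply (s : Finset (Fin n)) :
    (Pi.basisFun k (Fin n)).ExteriorAlgebra s = ((s.sort (· ≤ ·)).map (extX k)).prod := by
  rw [ExteriorAlgebra.basis_apply_ofCard _ rfl, ExteriorAlgebra.ιMulti_family,
    ExteriorAlgebra.ιMulti_apply, ← Finset.listMap_orderEmbOfFin_finRange s rfl, List.ofFn_eq_map,
    List.map_map]
  congr 1
  refine List.map_congr_left fun i _ => ?_
  simp [extX, Set.powersetCard.ofFinEmbEquiv_symm_apply]

/-- Basis of the Clifford algebra. -/
noncomputable def cliffBasis : Module.Basis (Finset (Fin n)) k (CliffordAlgebra (cliffQ a)) :=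
  ((Pi.basisFun k (Fin n)).ExteriorAlgebra).map
    (CliffordAlgebra.changeFormEquiv (cliff_h a)).symm

theorem cliffBasis_apply (s : Finset (Fin n)) :
    cliffBasis a s = ((s.sort (· ≤ ·)).map (cliffX a)).prod := by
  rw [cliffBasis, Module.Basis.map_apply, LinearEquiv.symm_apply_eq, ext_basis_apply]
  exact (change_list a _ s.sortedLT_sort.pairwise).symm

end CliffModel

section BilModel
variable {k : Type*} [Field k] {X : Type*}

/-- Bilinear extension of an operation on diwords. -/
noncomputable def bilB (k : Type*) [Field k] {X : Type*}
    (o : NDiword X → NDiword X → NDiword X) :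
    FreeDialg k X →ₗ[k] FreeDialg k X →ₗ[k] FreeDialg k X :=
  Finsupp.linearCombination k
    (fun u => Finsupp.linearCombination k (fun v => Finsupp.single (o u v) (1 : k)))

theorem bilB_eq (o : NDiword X → NDiword X → NDiword X) (f g : FreeDialg k X) :
    bilB k o f g = f.sum fun u a => g.sum fun v b => Finsupp.single (o u v) (a * b) := by
  simp [bilB, Finsupp.linearCombination_apply, Finsupp.sum, LinearMap.sum_apply, Finset.smul_sum]

theorem lmul_eq (f g : FreeDialg k X) : lmul f g = bilB k NDiword.lconc f g :=
  (bilB_eq _ _ _).symm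

theorem rmul_eq (f g : FreeDialg k X) : rmul f g = bilB k NDiword.rconc f g :=
  (bilB_eq _ _ _).symm

theorem bilB_single (o : NDiword X → NDiword X → NDiword X) (u v : NDiword X) (r s : k) :
    bilB k o (Finsupp.single u r) (Finsupp.single v s) = Finsupp.single (o u v) (r * s) := by
  simp [bilB]

theorem bilB_assoc (o1 o2 o3 o4 : NDiword X → NDiword X → NDiword X)
    (h : ∀ u v w, o1 u (o2 v w) = o3 (o4 u v) w) (f g l : FreeDialg k X) :
    bilB k o1 f (bilB k o2 g l) = bilB k o3 (bilB k o4 f g) l := by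
  induction f using Finsupp.induction_linear with
  | zero => simp
  | add f f' hf hf' => simp [hf, hf']
  | single u r =>
    induction g using Finsupp.induction_linear with
    | zero => simp
    | add f f' hf hf' => simp [hf, hf']
    | single v s =>
      induction l using Finsupp.induction_linear with
      | zero => simp
      | add f f' hf hf' => simp [hf, hf']
      | single w t => rw [bilB_single, bilB_single, bilB_single, bilB_single, h, mul_assoc]

theorem rr_assoc (f g h : FreeDialg k X) : rmul f (rmul g h) = rmul (rmul f g) h := by
  simp only [rmul_eq]
  exact bilB_assoc _ _ _ _ (by simp [NDiword.rconc, NDiword.word]) f g h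

theorem rl_assoc (f g h : FreeDialg k X) : rmul f (lmul g h) = rmul (rmul f g) h := by
  simp only [rmul_eq, lmul_eq]
  exact bilB_assoc _ _ _ _ (by simp [NDiword.rconc, NDiword.lconc, NDiword.word]) f g h

theorem lr_assoc (f g h : FreeDialg k X) : lmul f (rmul g h) = rmul (lmul f g) h := by
  simp only [rmul_eq, lmul_eq]
  exact bilB_assoc _ _ _ _ (by simp [NDiword.rconc, NDiword.lconc]) f g h

theorem ll_assoc (f g h : FreeDialg k X) : lmul f (lmul g h) = lmul (lmul f g) h := by
  simp only [lmul_eq]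
  exact bilB_assoc _ _ _ _ (by simp [NDiword.lconc, NDiword.word]) f g h

theorem lr_assoc' (f g h : FreeDialg k X) : lmul f (lmul g h) = lmul (rmul f g) h := by
  simp only [lmul_eq, rmul_eq]
  exact bilB_assoc _ _ _ _ (by simp [NDiword.rconc, NDiword.lconc, NDiword.word]) f g h

/-- left multiplication on the quotient -/
noncomputable def opL (S : Set (FreeDialg k X)) (g : FreeDialg k X) :
    (FreeDialg k X ⧸ dialgIdeal S) →ₗ[k] (FreeDialg k X ⧸ dialgIdeal S) :=
  (dialgIdeal S).mapQ (dialgIdeal S) (bilB k NDiword.lconc g) (fun f hf => by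
    have := IdealGen.lmul_left g (show IdealGen S f from hf)
    rw [lmul_eq] at this
    exact this)

/-- right multiplication on the quotient -/
noncomputable def opR (S : Set (FreeDialg k X)) (g : FreeDialg k X) :
    (FreeDialg k X ⧸ dialgIdeal S) →ₗ[k] (FreeDialg k X ⧸ dialgIdeal S) :=
  (dialgIdeal S).mapQ (dialgIdeal S) ((bilB k NDiword.rconc).flip g) (fun f hf => by
    have := IdealGen.rmul_right g (show IdealGen S f from hf)
    rw [rmul_eq] at this
    exact this)

theorem opL_mk (S : Set (FreeDialg k X)) (g f : FreeDialg k X) :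
    opL S g ((dialgIdeal S).mkQ f) = (dialgIdeal S).mkQ (lmul g f) := by
  rw [lmul_eq]; rfl

theorem opR_mk (S : Set (FreeDialg k X)) (g f : FreeDialg k X) :
    opR S g ((dialgIdeal S).mkQ f) = (dialgIdeal S).mkQ (rmul f g) := by
  rw [rmul_eq]; rfl

theorem opL_opR (S : Set (FreeDialg k X)) (g h : FreeDialg k X)
    (d : FreeDialg k X ⧸ dialgIdeal S) : opL S g (opR S h d) = opR S h (opL S g d) := by
  obtain ⟨f, rfl⟩ := (dialgIdeal S).mkQ_surjective d
  simp only [opL_mk, opR_mk, lr_assoc]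

theorem mk_zero (S : Set (FreeDialg k X)) {f : FreeDialg k X} (h : IdealGen S f) :
    (dialgIdeal S).mkQ f = 0 := by
  rw [Submodule.mkQ_apply, Submodule.Quotient.mk_eq_zero]; exact h

/-- the class of a diword -/
noncomputable def cls (S : Set (FreeDialg k X)) (l : List X) (y : X) (r : List X) :
    FreeDialg k X ⧸ dialgIdeal S :=
  (dialgIdeal S).mkQ (Finsupp.single ⟨l, y, r⟩ 1)

theorem cls_append (S : Set (FreeDialg k X)) (l : List X) (y : X) (r : List X) (z : X) :
    cls S l y (r ++ [z]) = opR S (ofX k z) (cls S l y r) := by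
  rw [cls, cls, opR_mk, rmul_eq, ofX, bilB_single]
  simp [NDiword.rconc, NDiword.word]

theorem cls_cons (S : Set (FreeDialg k X)) (l : List X) (y : X) (r : List X) (z : X) :
    cls S (z :: l) y r = opL S (ofX k z) (cls S l y r) := by
  rw [cls, cls, opL_mk, lmul_eq, ofX, bilB_single]
  simp [NDiword.lconc, NDiword.word]

theorem cls_span (S : Set (FreeDialg k X)) (T : Submodule k (FreeDialg k X ⧸ dialgIdeal S))
    (h : ∀ l y r, cls S l y r ∈ T) (d) : d ∈ T := by
  obtain ⟨f, rfl⟩ := (dialgIdeal S).mkQ_surjective d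
  induction f using Finsupp.induction_linear with
  | zero => simp
  | add f g hf hg => rw [map_add]; exact T.add_mem hf hg
  | single u r =>
    have : Finsupp.single u r = r • Finsupp.single u (1 : k) := by simp
    rw [this, map_smul]
    exact T.smul_mem _ (h _ _ _)

end BilModel

section SpanPart
variable {k : Type*} [Field k] {n : ℕ}

/-- The defining facts of the ideal. -/
structure CliffRel (a : Fin n → Fin n → k) (S : Set (FreeDialg k (Option (Fin n)))) : Prop where
  xx : ∀ i j, IdealGen S (lmul (ofX k (some i)) (ofX k (some j))
          + rmul (ofX k (some j)) (ofX k (some i))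
          - (2 * a i j) • ofX k (none : Option (Fin n)))
  ey : ∀ y, IdealGen S (lmul (ofX k (none : Option (Fin n))) (ofX k y) - ofX k y)
  ye : ∀ y, IdealGen S (rmul (ofX k y) (ofX k (none : Option (Fin n))) - ofX k y)

variable {a : Fin n → Fin n → k} {S : Set (FreeDialg k (Option (Fin n)))}

theorem opR_none (H : CliffRel a S) (d) : opR S (ofX k none) d = d := by
  refine cls_span S (LinearMap.eqLocus (opR S (ofX k none)) LinearMap.id) ?_ d
  intro l y r
  show opR S (ofX k none) (cls S l y r) = cls S l y r
  induction l with
  | cons z l ih => rw [cls_cons, ← opL_opR, ih]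
  | nil =>
    rcases List.eq_nil_or_concat r with rfl | ⟨r, z, rfl⟩
    · have := mk_zero S (H.ye y)
      rw [map_sub, sub_eq_zero, ← opR_mk] at this
      exact this
    · rw [List.concat_eq_append, cls_append, cls, opR_mk, opR_mk]
      have := mk_zero S (IdealGen.rmul_left (Finsupp.single ⟨[], y, r⟩ 1) (H.ye z))
      rw [rmul_eq, map_sub, map_sub, ← rmul_eq, ← rmul_eq, sub_eq_zero, rr_assoc] at this
      exact this

theorem opR_rel (H : CliffRel a S) (i j : Fin n) (d) :
    opR S (ofX k (some j)) (opR S (ofX k (some i)) d)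
      + opR S (ofX k (some i)) (opR S (ofX k (some j)) d) = (2 * a i j) • d := by
  conv_rhs => rw [← opR_none H d]
  obtain ⟨f, rfl⟩ := (dialgIdeal S).mkQ_surjective d
  have := mk_zero S (IdealGen.rmul_left f (H.xx i j))
  rw [rmul_eq, map_sub, map_add, map_smul, ← rmul_eq, ← rmul_eq, ← rmul_eq, rr_assoc,
    rl_assoc, map_sub, sub_eq_zero, map_add, map_smul] at this
  simp only [opR_mk]
  exact this

theorem opL_rel (H : CliffRel a S) (i j : Fin n) (d) :
    opL S (ofX k (some i)) (opL S (ofX k (some j)) d)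
      + opL S (ofX k (some j)) (opL S (ofX k (some i)) d)
      = (2 * a i j) • opL S (ofX k none) d := by
  obtain ⟨f, rfl⟩ := (dialgIdeal S).mkQ_surjective d
  have := mk_zero S (IdealGen.lmul_right f (H.xx i j))
  rw [lmul_eq, map_sub, map_add, map_smul, LinearMap.sub_apply, LinearMap.add_apply,
    LinearMap.smul_apply, ← lmul_eq, ← lmul_eq, ← lmul_eq, ← ll_assoc, ← lr_assoc',
    map_sub, sub_eq_zero, map_add, map_smul] at this
  simp only [opL_mk]
  exact this

theorem opL_none_letter (H : CliffRel a S) (y) :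
    opL S (ofX k none) (cls S [] y []) = cls S [] y [] := by
  have := mk_zero S (H.ey y)
  rw [map_sub, sub_eq_zero, ← opL_mk] at this
  exact this

theorem opL_some_letter (H : CliffRel a S) (i j : Fin n) :
    opL S (ofX k (some i)) (cls S [] (some j) [])
      = (2 * a i j) • cls S [] none [] - opR S (ofX k (some i)) (cls S [] (some j) []) := by
  have := mk_zero S (H.xx i j)
  rw [map_sub, sub_eq_zero, map_add, map_smul, ← opL_mk, ← opR_mk] at this
  rw [eq_sub_iff_add_eq]
  exact this

theorem opL_some_none (h2 : (2 : k) ≠ 0) (hnz : a ≠ 0) (H : CliffRel a S) (i : Fin n) :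
    opL S (ofX k (some i)) (cls S [] none []) = opR S (ofX k (some i)) (cls S [] none []) := by
  have key : ∀ i p q : Fin n,
      a p q • (opL S (ofX k (some i)) (cls S [] none [])
        - opR S (ofX k (some i)) (cls S [] none [])) +
      a i q • (opL S (ofX k (some p)) (cls S [] none [])
        - opR S (ofX k (some p)) (cls S [] none [])) = 0 := by
    intro i p q
    have h1 := opL_rel H i p (cls S [] (some q) [])
    rw [opL_none_letter H, opL_some_letter H, opL_some_letter H, map_sub, map_sub, map_smul,
      map_smul, opL_opR, opL_opR, opL_some_letter H, opL_some_letter H, map_sub, map_sub,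
      map_smul, map_smul, ← opR_rel H i p] at h1
    have h3 : (2 : k) • (a p q • (opL S (ofX k (some i)) (cls S [] none [])
        - opR S (ofX k (some i)) (cls S [] none [])) +
      a i q • (opL S (ofX k (some p)) (cls S [] none [])
        - opR S (ofX k (some p)) (cls S [] none []))) = 0 := by
      rw [← sub_eq_zero] at h1
      rw [← h1]
      module
    exact (smul_eq_zero.mp h3).resolve_left h2
  obtain ⟨p, hp⟩ := Function.ne_iff.mp hnz
  obtain ⟨q, hq⟩ := Function.ne_iff.mp hp
  have hq : a p q ≠ 0 := hq
  have hp0 := key p p q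
  rw [← add_smul, ← two_mul] at hp0
  have hp1 := (smul_eq_zero.mp hp0).resolve_left (mul_ne_zero h2 hq)
  have hi := key i p q
  rw [hp1, smul_zero, add_zero] at hi
  exact sub_eq_zero.mp ((smul_eq_zero.mp hi).resolve_left hq)

/-- span of right normed words -/
noncomputable def spR (S : Set (FreeDialg k (Option (Fin n)))) :
    Submodule k (FreeDialg k (Option (Fin n)) ⧸ dialgIdeal S) :=
  Submodule.span k (Set.range fun p : Option (Fin n) × List (Option (Fin n)) => cls S [] p.1 p.2)

theorem cls_mem_spR (y : Option (Fin n)) (r) : cls S [] y r ∈ spR S :=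
  Submodule.subset_span ⟨(y, r), rfl⟩

theorem opR_mem_spR (z : Option (Fin n)) {d} (hd : d ∈ spR S) : opR S (ofX k z) d ∈ spR S := by
  have : spR S ≤ (spR S).comap (opR S (ofX k z)) := by
    conv_lhs => rw [spR]
    rw [Submodule.span_le]
    rintro _ ⟨p, rfl⟩
    show opR S (ofX k z) (cls S [] p.1 p.2) ∈ spR S
    rw [← cls_append]
    exact cls_mem_spR _ _
  exact this hd

theorem opL_mem_spR (h2 : (2 : k) ≠ 0) (hnz : a ≠ 0) (H : CliffRel a S)
    (z : Option (Fin n)) {d} (hd : d ∈ spR S) : opL S (ofX k z) d ∈ spR S := by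
  have : spR S ≤ (spR S).comap (opL S (ofX k z)) := by
    conv_lhs => rw [spR]
    rw [Submodule.span_le]
    rintro _ ⟨⟨y, r⟩, rfl⟩
    show opL S (ofX k z) (cls S [] y r) ∈ spR S
    induction r using List.reverseRecOn with
    | append_singleton r w ih =>
      rw [cls_append, opL_opR]
      exact opR_mem_spR _ ih
    | nil =>
      rcases z with _ | i
      · rw [opL_none_letter H]; exact cls_mem_spR _ _
      · rcases y with _ | j
        · rw [opL_some_none h2 hnz H]; exact opR_mem_spR _ (cls_mem_spR _ _)
        · rw [opL_some_letter H]
          exact Submodule.sub_mem _ (Submodule.smul_mem _ _ (cls_mem_spR _ _))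
            (opR_mem_spR _ (cls_mem_spR _ _))
  exact this hd

theorem spR_top (h2 : (2 : k) ≠ 0) (hnz : a ≠ 0) (H : CliffRel a S) (d) : d ∈ spR S := by
  refine cls_span S _ ?_ d
  intro l y r
  induction l with
  | nil => exact cls_mem_spR _ _
  | cons z l ih => rw [cls_cons]; exact opL_mem_spR h2 hnz H _ ih

/-- linear combination of right multiplications -/
noncomputable def linR (S : Set (FreeDialg k (Option (Fin n)))) :
    (Fin n → k) →ₗ[k] (Module.End k (FreeDialg k (Option (Fin n)) ⧸ dialgIdeal S))ᵐᵒᵖ :=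
  (MulOpposite.opLinearEquiv k).toLinearMap ∘ₗ
    Fintype.linearCombination k (fun i => opR S (ofX k (some i)))

theorem linR_sq (h2 : (2 : k) ≠ 0) (hsym : ∀ i j, a i j = a j i) (H : CliffRel a S)
    (v : Fin n → k) : linR S v * linR S v = algebraMap k _ (cliffQ a v) := by
  apply MulOpposite.unop_injective
  refine LinearMap.ext fun d => ?_
  have e1 : (MulOpposite.unop (linR S v * linR S v)) d
      = ∑ i, ∑ j, (v i * v j) • opR S (ofX k (some j)) (opR S (ofX k (some i)) d) := by
    simp [linR, Fintype.linearCombination_apply, LinearMap.sum_apply, Finset.smul_sum, mul_smul]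

  have e2 : (MulOpposite.unop (algebraMap k
      (Module.End k (FreeDialg k (Option (Fin n)) ⧸ dialgIdeal S))ᵐᵒᵖ (cliffQ a v))) d
      = ∑ i, ∑ j, (v i * v j) • (cliffT a i j • d) := by
    simp [cliffQ, Matrix.toBilin'_apply, Module.algebraMap_end_apply, Finset.sum_smul, smul_smul]
    refine Finset.sum_congr rfl fun i _ => Finset.sum_congr rfl fun j _ => ?_
    congr 1
    ring
  have hT : ∀ i j, cliffT a i j + cliffT a j i = 2 * a i j := by
    intro i j
    rw [← cliffQ_polar a hsym, cliffQ, LinearMap.BilinMap.polar_toQuadraticMap,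
      Matrix.toBilin'_single, Matrix.toBilin'_single]
  change (MulOpposite.unop (linR S v * linR S v)) d = (MulOpposite.unop (algebraMap k
      (Module.End k (FreeDialg k (Option (Fin n)) ⧸ dialgIdeal S))ᵐᵒᵖ (cliffQ a v))) d
  have symm : ∀ (G : Fin n → Fin n → FreeDialg k (Option (Fin n)) ⧸ dialgIdeal S),
      (2 : k) • ∑ i, ∑ j, (v i * v j) • G i j = ∑ i, ∑ j, (v i * v j) • (G i j + G j i) := by
    intro G
    simp only [smul_add, Finset.sum_add_distrib]
    rw [two_smul]
    congr 1
    rw [Finset.sum_comm]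
    simp only [mul_comm]
  rw [e1, e2]
  have : (2 : k) • ∑ i, ∑ j, (v i * v j) • opR S (ofX k (some j)) (opR S (ofX k (some i)) d)
     = (2 : k) • ∑ i, ∑ j, (v i * v j) • (cliffT a i j • d) := by
    rw [symm, symm]
    simp only [← add_smul, hT, opR_rel H]
  have h5 := congrArg (fun x => (2 : k)⁻¹ • x) this
  simpa [smul_smul, inv_mul_cancel₀ h2] using h5

/-- letters in the Clifford algebra -/
noncomputable def cliffC (a : Fin n → Fin n → k) : Option (Fin n) → CliffordAlgebra (cliffQ a)
  | none => 1
  | some i => cliffX a i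

theorem spR_le (h2 : (2 : k) ≠ 0) (hsym : ∀ i j, a i j = a j i) (H : CliffRel a S)
    (y : Option (Fin n)) (r : List (Option (Fin n))) :
    cls S [] y r ∈ Submodule.span k (Set.range (cliffFam (dialgIdeal S))) := by
  let Φ := CliffordAlgebra.lift (cliffQ a) ⟨linR S, linR_sq h2 hsym H⟩
  let ψ : CliffordAlgebra (cliffQ a) →ₗ[k] (FreeDialg k (Option (Fin n)) ⧸ dialgIdeal S) :=
    (LinearMap.applyₗ (cls S [] y [])) ∘ₗ (MulOpposite.opLinearEquiv k).symm.toLinearMap ∘ₗ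
      Φ.toLinearMap
  have hc : ∀ z d, MulOpposite.unop (Φ (cliffC a z)) d = opR S (ofX k z) d := by
    intro z d
    rcases z with _ | i
    · rw [opR_none H]; simp [cliffC]
    · simp only [cliffC, cliffX, Φ, CliffordAlgebra.lift_ι_apply]
      simp [linR]
  have hψ : ∀ r : List (Option (Fin n)), ψ ((r.map (cliffC a)).prod) = cls S [] y r := by
    intro r
    induction r using List.reverseRecOn with
    | nil => simp [ψ]
    | append_singleton r z ih =>
      rw [cls_append, ← ih, ← hc]
      simp [ψ]
  rw [← hψ]
  generalize (r.map (cliffC a)).prod = x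
  have : (⊤ : Submodule k (CliffordAlgebra (cliffQ a))) ≤
      (Submodule.span k (Set.range (cliffFam (dialgIdeal S)))).comap ψ := by
    rw [← (cliffBasis a).span_eq, Submodule.span_le]
    rintro _ ⟨s, rfl⟩
    show ψ (cliffBasis a s) ∈ Submodule.span k (Set.range (cliffFam (dialgIdeal S)))
    have e : (s.sort (· ≤ ·)).map (cliffX a) = ((s.sort (· ≤ ·)).map some).map (cliffC a) := by
      rw [List.map_map]; rfl
    rw [cliffBasis_apply, e, hψ]
    exact Submodule.subset_span ⟨⟨(y, s.sort (· ≤ ·)), s.sortedLT_sort.pairwise.isChain⟩, rfl⟩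
  exact this trivial

end SpanPart

section ModelPart
variable {k : Type*} [Field k] {n : ℕ}

/-- left action matrices, entries -/
noncomputable def cliffM (a : Fin n → Fin n → k) (v : Fin n → k) :
    Option (Fin n) → Option (Fin n) → CliffordAlgebra (cliffQ a)
  | none, none => CliffordAlgebra.ι (cliffQ a) v
  | none, some j => algebraMap k _ ((cliffQ a).polarBilin v (Pi.single j 1))
  | some _, none => 0
  | some i, some j => if i = j then - CliffordAlgebra.ι (cliffQ a) v else 0

/-- left action matrices -/
noncomputable def cliffLin (a : Fin n → Fin n → k) :
    (Fin n → k) →ₗ[k] Matrix (Option (Fin n)) (Option (Fin n)) (CliffordAlgebra (cliffQ a)) where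
  toFun v := Matrix.of (cliffM a v)
  map_add' v w := by
    ext y z
    rw [Matrix.add_apply, Matrix.of_apply, Matrix.of_apply, Matrix.of_apply]
    rcases y with _ | i <;> rcases z with _ | j <;> simp only [cliffM]
    · rw [map_add]
    · rw [map_add, LinearMap.add_apply, map_add]
    · simp
    · rw [map_add]
      split_ifs
      · abel
      · simp
  map_smul' c v := by
    ext y z
    rw [Matrix.smul_apply, Matrix.of_apply, Matrix.of_apply, RingHom.id_apply]
    rcases y with _ | i <;> rcases z with _ | j <;> simp only [cliffM]
    · rw [map_smul]
    · rw [map_smul, LinearMap.smul_apply, smul_eq_mul, map_mul, Algebra.smul_def]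
    · simp
    · rw [map_smul]
      split_ifs
      · simp
      · simp

theorem cliffLin_apply (a : Fin n → Fin n → k) (v : Fin n → k) (y z) :
    cliffLin a v y z = cliffM a v y z := rfl

theorem cliffLin_sq (a : Fin n → Fin n → k) (v : Fin n → k) :
    cliffLin a v * cliffLin a v = algebraMap k _ (cliffQ a v) := by
  ext y z
  rw [Matrix.mul_apply, Fintype.sum_option, Matrix.algebraMap_matrix_apply]
  simp only [cliffLin_apply]
  rcases y with _ | i <;> rcases z with _ | j
  · simp [cliffM]
  · simp only [cliffM, mul_ite, mul_zero, mul_neg, Finset.sum_ite_eq', Finset.mem_univ, if_true,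
      reduceCtorEq, if_false]
    rw [Algebra.commutes]
    simp
  · simp [cliffM]
  · simp only [cliffM, Option.some.injEq, zero_mul, zero_add]
    by_cases h : i = j
    · subst h; simp
    · simp [h]

/-- left action -/
noncomputable def cliffL (a : Fin n → Fin n → k) : CliffordAlgebra (cliffQ a) →ₐ[k]
    Matrix (Option (Fin n)) (Option (Fin n)) (CliffordAlgebra (cliffQ a)) :=
  CliffordAlgebra.lift (cliffQ a) ⟨cliffLin a, cliffLin_sq a⟩

/-- image in the Clifford algebra -/
noncomputable def mPhi (a : Fin n → Fin n → k) :
    FreeDialg k (Option (Fin n)) →ₗ[k] CliffordAlgebra (cliffQ a) :=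
  Finsupp.linearCombination k fun w => (w.word.map (cliffC a)).prod

/-- image in the model -/
noncomputable def mF (a : Fin n → Fin n → k) :
    FreeDialg k (Option (Fin n)) →ₗ[k] (Option (Fin n) → CliffordAlgebra (cliffQ a)) :=
  Finsupp.linearCombination k fun w y =>
    cliffL a ((w.left.map (cliffC a)).prod) y w.center * (w.right.map (cliffC a)).prod

variable (a : Fin n → Fin n → k)

theorem mPhi_single (w : NDiword (Option (Fin n))) (r : k) :
    mPhi a (Finsupp.single w r) = r • (w.word.map (cliffC a)).prod := by
  simp [mPhi]

theorem mF_single (w : NDiword (Option (Fin n))) (r : k) :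
    mF a (Finsupp.single w r) = r • fun y =>
      cliffL a ((w.left.map (cliffC a)).prod) y w.center * (w.right.map (cliffC a)).prod := by
  simp [mF]

theorem mPhi_lmul (f g : FreeDialg k (Option (Fin n))) :
    mPhi a (lmul f g) = mPhi a f * mPhi a g := by
  rw [lmul_eq]
  induction f using Finsupp.induction_linear with
  | zero => simp
  | add f f' hf hf' => simp [hf, hf', add_mul]
  | single u r =>
    induction g using Finsupp.induction_linear with
    | zero => simp
    | add f f' hf hf' => simp [hf, hf', mul_add]
    | single v s =>
      rw [bilB_single, mPhi_single, mPhi_single, mPhi_single, smul_mul_smul_comm]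
      simp [NDiword.lconc, NDiword.word, mul_assoc]

theorem mPhi_rmul (f g : FreeDialg k (Option (Fin n))) :
    mPhi a (rmul f g) = mPhi a f * mPhi a g := by
  rw [rmul_eq]
  induction f using Finsupp.induction_linear with
  | zero => simp
  | add f f' hf hf' => simp [hf, hf', add_mul]
  | single u r =>
    induction g using Finsupp.induction_linear with
    | zero => simp
    | add f f' hf hf' => simp [hf, hf', mul_add]
    | single v s =>
      rw [bilB_single, mPhi_single, mPhi_single, mPhi_single, smul_mul_smul_comm]
      simp [NDiword.rconc, NDiword.word, mul_assoc]

theorem mF_lmul (f g : FreeDialg k (Option (Fin n))) :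
    mF a (lmul f g) = (cliffL a (mPhi a f)).mulVec (mF a g) := by
  rw [lmul_eq]
  induction f using Finsupp.induction_linear with
  | zero => simp
  | add f f' hf hf' => simp [hf, hf', Matrix.add_mulVec]
  | single u r =>
    induction g using Finsupp.induction_linear with
    | zero => simp
    | add f f' hf hf' => simp [hf, hf', Matrix.mulVec_add]
    | single v s =>
      rw [bilB_single, mPhi_single, mF_single, mF_single, map_smul, Matrix.smul_mulVec,
        Matrix.mulVec_smul, smul_smul]
      congr 1
      ext y
      simp only [NDiword.lconc, List.map_append, List.prod_append, map_mul, Matrix.mul_apply,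
        Matrix.mulVec, dotProduct, Finset.sum_mul, mul_assoc]

theorem mF_rmul (f g : FreeDialg k (Option (Fin n))) :
    mF a (rmul f g) = fun y => mF a f y * mPhi a g := by
  rw [rmul_eq]
  induction f using Finsupp.induction_linear with
  | zero => ext y; simp
  | add f f' hf hf' => ext y; simp [hf, hf', add_mul]
  | single u r =>
    induction g using Finsupp.induction_linear with
    | zero => ext y; simp
    | add f f' hf hf' => ext y; simp [hf, hf', mul_add]
    | single v s =>
      rw [bilB_single, mPhi_single, mF_single, mF_single]
      ext y
      simp only [NDiword.rconc, List.map_append, List.prod_append, Pi.smul_apply,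
        smul_mul_smul_comm, mul_assoc]

theorem mPhi_ofX (y : Option (Fin n)) : mPhi a (ofX k y) = cliffC a y := by
  rw [ofX, mPhi_single]; simp [NDiword.word]

theorem mF_ofX (y : Option (Fin n)) : mF a (ofX k y) = Pi.single y 1 := by
  rw [ofX, mF_single]
  ext z
  simp [Matrix.one_apply, Pi.single_apply]

theorem m_ideal (S : Set (FreeDialg k (Option (Fin n))))
    (h : ∀ s ∈ S, mPhi a s = 0 ∧ mF a s = 0) {f} (hf : IdealGen S f) :
    mPhi a f = 0 ∧ mF a f = 0 := by
  induction hf with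
  | of hs => exact h _ hs
  | zero => simp
  | add _ _ h1 h2 => simp [h1, h2]
  | smul r _ h1 => simp [h1]
  | lmul_left g _ h1 => rw [mPhi_lmul, mF_lmul, h1.1, h1.2]; simp
  | lmul_right g _ h1 => rw [mPhi_lmul, mF_lmul, h1.1]; simp
  | rmul_left g _ h1 => rw [mPhi_rmul, mF_rmul, h1.1]; simp; rfl
  | rmul_right g _ h1 => rw [mPhi_rmul, mF_rmul, h1.1, h1.2]; simp; rfl

theorem m_xx (hsym : ∀ i j, a i j = a j i) (i j : Fin n) :
    mPhi a (lmul (ofX k (some i)) (ofX k (some j)) + rmul (ofX k (some j)) (ofX k (some i))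
          - (2 * a i j) • ofX k (none : Option (Fin n))) = 0 ∧
    mF a (lmul (ofX k (some i)) (ofX k (some j)) + rmul (ofX k (some j)) (ofX k (some i))
          - (2 * a i j) • ofX k (none : Option (Fin n))) = 0 := by
  constructor
  · rw [map_sub, map_add, map_smul, mPhi_lmul, mPhi_rmul]
    simp only [mPhi_ofX, cliffC]
    rw [cliffX_mul a hsym, Algebra.algebraMap_eq_smul_one, sub_self]
  · rw [map_sub, map_add, map_smul, mF_lmul, mF_rmul]
    simp only [mPhi_ofX, mF_ofX, cliffC]
    rw [cliffL, cliffX, CliffordAlgebra.lift_ι_apply, Matrix.mulVec_single_one]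
    ext y
    rcases y with _ | p
    · have := cliffQ_polar a hsym i j
      simp [cliffLin_apply, cliffM, this, Algebra.algebraMap_eq_smul_one]
    · by_cases h : p = j
      · subst h; simp [cliffLin_apply, cliffM]
      · simp [cliffLin_apply, cliffM, h]

theorem m_ey (y : Option (Fin n)) :
    mPhi a (lmul (ofX k (none : Option (Fin n))) (ofX k y) - ofX k y) = 0 ∧
    mF a (lmul (ofX k (none : Option (Fin n))) (ofX k y) - ofX k y) = 0 := by
  rw [map_sub, map_sub, mPhi_lmul, mF_lmul]
  simp [mPhi_ofX, cliffC]

theorem m_ye (y : Option (Fin n)) :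
    mPhi a (rmul (ofX k y) (ofX k (none : Option (Fin n))) - ofX k y) = 0 ∧
    mF a (rmul (ofX k y) (ofX k (none : Option (Fin n))) - ofX k y) = 0 := by
  rw [map_sub, map_sub, mPhi_rmul, mF_rmul]
  simp [mPhi_ofX, cliffC]

theorem li_congr {k M ι : Type*} [Field k] [AddCommGroup M] [Module k M] {f g : ι → M}
    (h : f = g) (hg : LinearIndependent k g) : LinearIndependent k f := h ▸ hg

theorem cliff_indep :
    LinearIndependent k (fun p : {p : Option (Fin n) × List (Fin n) // List.IsChain (· < ·) p.2} =>
      (Pi.single p.1.1 ((p.1.2.map (cliffX a)).prod) :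
        Option (Fin n) → CliffordAlgebra (cliffQ a))) := by
  have h := (Pi.basis (fun _ : Option (Fin n) => cliffBasis a)).linearIndependent
  let g : {p : Option (Fin n) × List (Fin n) // List.IsChain (· < ·) p.2} →
      (Σ _ : Option (Fin n), Finset (Fin n)) := fun p => ⟨p.1.1, p.1.2.toFinset⟩
  have hsort : ∀ l : List (Fin n), l.IsChain (· < ·) → l.toFinset.sort (· ≤ ·) = l := by
    intro l hl
    have hp : l.Pairwise (· < ·) := List.isChain_iff_pairwise.mp hl
    exact (List.toFinset_sort (· ≤ ·) (hp.imp (fun h => h.ne))).mpr (hp.imp (fun h => h.le))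
  have hg : Function.Injective g := by
    rintro ⟨⟨y, l⟩, hl⟩ ⟨⟨y', l'⟩, hl'⟩ h
    simp only [g, Sigma.mk.injEq, heq_eq_eq] at h
    obtain ⟨rfl, h⟩ := h
    have := hsort l hl
    rw [h, hsort l' hl'] at this
    subst this
    rfl
  have := h.comp g hg
  refine li_congr ?_ this
  funext p
  simp [g, Pi.basis_apply, cliffBasis_apply, hsort _ p.2]

end ModelPart

/-- STATEMENT 19: a linear basis for the Clifford dialgebra `C(n, f)` over a field
of characteristic `≠ 2`, for a nonzero symmetric matrix `(a_{ij})`.  Here the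
letter `none` plays the role of `e` and `some i` of `x_i`. -/
theorem clifford_dialgebra_basis {k : Type*} [Field k] (h2 : (2 : k) ≠ 0)
    (n : ℕ) (hn : 1 ≤ n) (a : Fin n → Fin n → k)
    (hsym : ∀ i j, a i j = a j i) (hnz : a ≠ 0)
    (S : Set (FreeDialg k (Option (Fin n))))
    (hS : S =
      {f | ∃ i j : Fin n, f = lmul (ofX k (some i)) (ofX k (some j))
          + rmul (ofX k (some j)) (ofX k (some i))
          - (2 * a i j) • ofX k (none : Option (Fin n))} ∪
      {f | ∃ y : Option (Fin n),
          f = lmul (ofX k (none : Option (Fin n))) (ofX k y) - ofX k y} ∪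
      {f | ∃ y : Option (Fin n),
          f = rmul (ofX k y) (ofX k (none : Option (Fin n))) - ofX k y}) :
    LinearIndependent k (cliffFam (dialgIdeal S)) ∧
    Submodule.span k (Set.range (cliffFam (dialgIdeal S))) = ⊤ := by
  have H : CliffRel a S := by
    subst hS
    exact ⟨fun i j => IdealGen.of (Or.inl (Or.inl ⟨i, j, rfl⟩)),
      fun y => IdealGen.of (Or.inl (Or.inr ⟨y, rfl⟩)), fun y => IdealGen.of (Or.inr ⟨y, rfl⟩)⟩
  constructor
  · have hker : dialgIdeal S ≤ LinearMap.ker (mF a) := by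
      intro f hf
      refine (m_ideal a S ?_ hf).2
      subst hS
      rintro s ((⟨i, j, rfl⟩ | ⟨y, rfl⟩) | ⟨y, rfl⟩)
      · exact m_xx a hsym i j
      · exact m_ey a y
      · exact m_ye a y
    refine LinearIndependent.of_comp ((dialgIdeal S).liftQ (mF a) hker) ?_
    refine li_congr ?_ (cliff_indep a)
    funext p
    show mF a (Finsupp.single ⟨[], p.1.1, p.1.2.map some⟩ 1) = _
    rw [mF_single]
    ext z
    have e : (p.1.2.map some).map (cliffC a) = p.1.2.map (cliffX a) := by
      rw [List.map_map]; rfl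
    rw [e]
    by_cases h : z = p.1.1
    · subst h; simp
    · simp [h]
  · rw [eq_top_iff]
    intro d _
    have h : spR S ≤ Submodule.span k (Set.range (cliffFam (dialgIdeal S))) := by
      rw [spR, Submodule.span_le]
      rintro _ ⟨p, rfl⟩
      exact spR_le h2 hsym H p.1 p.2
    exact h (spR_top h2 hnz H d)
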